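/- Let m>1, 0<p<1 with m+p>2, σ>2(1−p)/(m−1). There is no positive C² solution f of the profile ODE on an interval (R,∞), R>0, such that both ξ^{σ−2} f(ξ)^{m+p−2} → ∞ and ξ^{σ} f(ξ)^{p−1} → ∞ as ξ→∞. -/

import Mathlib

open Real Filter Set Topology

/-- The function `f^m` (real power). -/
noncomputable def Fm (m : ℝ) (f : ℝ → ℝ) : ℝ → ℝ := fun ξ => f ξ ^ m

/-- `f` solves the self-similar profile ODE
`(f^m)'' - α f + β ξ f' + ξ^σ f^p = 0` on the set `S`. -/
noncomputable def SolvesODE (m p σ α β : ℝ) (f : ℝ → ℝ) (S : Set ℝ) : Prop :=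
  ∀ ξ ∈ S,
    deriv (deriv (Fm m f)) ξ - α * f ξ + β * ξ * deriv f ξ + ξ ^ σ * f ξ ^ p = 0

/-- A profile: continuous and nonnegative on `[0,∞)`, with `f^m` of class `C²`
on the (positive-space) positivity set, solving the profile ODE there. -/
noncomputable def IsProfile (m p σ α β : ℝ) (f : ℝ → ℝ) : Prop :=
  ContinuousOn f (Set.Ici 0) ∧ (∀ ξ ∈ Set.Ici (0 : ℝ), 0 ≤ f ξ) ∧
    ContDiffOn ℝ 2 (Fm m f) {ξ : ℝ | 0 < ξ ∧ 0 < f ξ} ∧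
    SolvesODE m p σ α β f {ξ : ℝ | 0 < ξ ∧ 0 < f ξ}

/-- Behavior (P1) at the origin: `f(0) = a > 0`, `f'(0) = 0`. -/
noncomputable def GoodP1 (f : ℝ → ℝ) : Prop :=
  0 < f 0 ∧ HasDerivWithinAt f 0 (Set.Ici 0) 0

/-- Behavior (P2) at the origin: `f(0) = 0`, `(f^m)'(0) = 0`. -/
noncomputable def GoodP2 (m : ℝ) (f : ℝ → ℝ) : Prop :=
  f 0 = 0 ∧ HasDerivWithinAt (Fm m f) 0 (Set.Ici 0) 0

/-- `f` has an interface at `ξ₀ ∈ (0,∞)`: `f(ξ₀) = 0`, `(f^m)'(ξ₀) = 0`, and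
`f > 0` on a left-neighborhood of `ξ₀`. -/
noncomputable def HasInterface (m : ℝ) (f : ℝ → ℝ) (ξ₀ : ℝ) : Prop :=
  0 < ξ₀ ∧ f ξ₀ = 0 ∧ HasDerivAt (Fm m f) 0 ξ₀ ∧
    ∃ δ > 0, ∀ ξ ∈ Set.Ioo (ξ₀ - δ) ξ₀, 0 < f ξ

/-- Type I interface behavior at `ξ₀`: `f(ξ)(ξ₀-ξ)^{-1/(m-1)}` has a finite
positive limit as `ξ → ξ₀⁻`. -/
noncomputable def TypeI (m : ℝ) (f : ℝ → ℝ) (ξ₀ : ℝ) : Prop :=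
  ∃ L > 0, Filter.Tendsto (fun ξ => f ξ * (ξ₀ - ξ) ^ (-(1 / (m - 1))))
    (nhdsWithin ξ₀ (Set.Iio ξ₀)) (nhds L)

/-- Type II interface behavior at `ξ₀`: `f(ξ)(ξ₀-ξ)^{-1/(1-p)}` has a finite
positive limit as `ξ → ξ₀⁻`. -/
noncomputable def TypeII (p : ℝ) (f : ℝ → ℝ) (ξ₀ : ℝ) : Prop :=
  ∃ L > 0, Filter.Tendsto (fun ξ => f ξ * (ξ₀ - ξ) ^ (-(1 / (1 - p))))
    (nhdsWithin ξ₀ (Set.Iio ξ₀)) (nhds L)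

/-- Comparison of increments on a half-line from comparison of derivatives. -/
lemma sub_le_sub_of_hasDerivAt_le {g B g' B' : ℝ → ℝ} {a : ℝ}
    (hg : ∀ x ≥ a, HasDerivAt g (g' x) x) (hB : ∀ x ≥ a, HasDerivAt B (B' x) x)
    (hle : ∀ x ≥ a, g' x ≤ B' x) {x : ℝ} (hx : a ≤ x) : g x - g a ≤ B x - B a := by
  have hd : ∀ y ≥ a, HasDerivAt (fun z => g z - B z) (g' y - B' y) y :=
    fun y hy => (hg y hy).sub (hB y hy)
  have hanti : AntitoneOn (fun z => g z - B z) (Ici a) := by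
    refine antitoneOn_of_deriv_nonpos (convex_Ici a)
      (fun y hy => (hd y hy).continuousAt.continuousWithinAt)
      (fun y hy => ?_) (fun y hy => ?_)
    · exact (hd y (interior_subset hy)).differentiableAt.differentiableWithinAt
    · rw [(hd y (interior_subset hy)).deriv]
      linarith [hle y (interior_subset hy)]
  have := hanti (mem_Ici.2 le_rfl) (mem_Ici.2 hx) hx
  simp only at this
  linarith

/-- A function whose derivative is bounded above by a negative constant on a half-line
takes negative values. -/
lemma exists_neg_of_hasDerivAt_le_neg {g g' : ℝ → ℝ} {a c : ℝ} (hc : 0 < c)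
    (hg : ∀ x ≥ a, HasDerivAt g (g' x) x) (hle : ∀ x ≥ a, g' x ≤ -c) :
    ∃ x ≥ a, g x < 0 := by
  have hx : a ≤ a + (|g a| + 1) / c := by
    have : 0 < (|g a| + 1) / c := by positivity
    linarith
  have h := sub_le_sub_of_hasDerivAt_le hg (B := fun x => -c * x) (B' := fun _ => -c)
    (fun x _ => by simpa using (hasDerivAt_id x).const_mul (-c)) hle hx
  refine ⟨_, hx, ?_⟩
  have e : c * ((|g a| + 1) / c) = |g a| + 1 := by field_simp
  have := le_abs_self (g a)
  linarith

/-- No positive function on a half-line satisfies `G' ≤ -C G^p / x` with `p < 1`. -/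
lemma false_of_hasDerivAt_le_neg_rpow {G G' : ℝ → ℝ} {a C p : ℝ} (ha : 1 ≤ a) (hC : 0 < C)
    (hp : p < 1) (hG : ∀ x ≥ a, HasDerivAt G (G' x) x) (hpos : ∀ x ≥ a, 0 < G x)
    (hle : ∀ x ≥ a, G' x ≤ -C * G x ^ p / x) : False := by
  set K := (1 - p) * C with hK
  have hKpos : 0 < K := mul_pos (by linarith) hC
  have hd : ∀ x ≥ a, HasDerivAt (fun y => G y ^ (1 - p)) (G' x * (1 - p) * G x ^ (1 - p - 1)) x :=
    fun x hx => (hG x hx).rpow_const (Or.inl (hpos x hx).ne')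
  have hB : ∀ x ≥ a, HasDerivAt (fun y => -K * log y) (-K * x⁻¹) x := fun x hx =>
    (Real.hasDerivAt_log (by linarith : x ≠ 0)).const_mul (-K)
  have hcmp : ∀ x ≥ a, G' x * (1 - p) * G x ^ (1 - p - 1) ≤ -K * x⁻¹ := by
    intro x hx
    have hx0 : 0 < x := by linarith
    have hGp := rpow_pos_of_pos (hpos x hx) p
    have e : G x ^ (1 - p - 1) = (G x ^ p)⁻¹ := by
      rw [← rpow_neg (hpos x hx).le]; congr 1; ring
    rw [e]
    calc G' x * (1 - p) * (G x ^ p)⁻¹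
        ≤ (-C * G x ^ p / x) * (1 - p) * (G x ^ p)⁻¹ := by
          have : 0 ≤ 1 - p := by linarith
          gcongr
          exact hle x hx
      _ = -K * x⁻¹ := by rw [hK]; field_simp
  have hlog : Tendsto (fun x => K * log x) atTop atTop :=
    tendsto_log_atTop.const_mul_atTop hKpos
  obtain ⟨x, hx1, hx2⟩ := ((hlog.eventually_gt_atTop (K * log a + G a ^ (1 - p))).and
    (eventually_ge_atTop a)).exists
  have h := sub_le_sub_of_hasDerivAt_le hd hB hcmp hx2
  have := rpow_pos_of_pos (hpos x hx2) (1 - p)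
  linarith

/-- If `v' < 0` wherever `v = 0`, then `v` stays nonpositive once it is. -/
lemma nonpos_of_hasDerivAt_neg_of_eq_zero {v v' : ℝ → ℝ} {a : ℝ}
    (hv : ∀ x ≥ a, HasDerivAt v (v' x) x) (hneg : ∀ x ≥ a, v x = 0 → v' x < 0)
    (ha : v a ≤ 0) {x : ℝ} (hx : a ≤ x) : v x ≤ 0 :=
  image_le_of_deriv_right_lt_deriv_boundary (a := a) (b := x) (B := fun _ => 0) (B' := fun _ => 0)
    (fun y hy => (hv y hy.1).continuousAt.continuousWithinAt)
    (fun y hy => (hv y hy.1).hasDerivWithinAt) ha (fun y => hasDerivAt_const y 0)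
    (fun y hy hy0 => hneg y hy.1 hy0) ⟨hx, le_rfl⟩

/-- there is no positive `C²` solution of the profile ODE on
`(R,∞)` with both `ξ^{σ-2} f(ξ)^{m+p-2} → ∞` and `ξ^σ f(ξ)^{p-1} → ∞` as
`ξ → ∞` (non-admissibility of the critical point `Q₄`). -/
theorem no_solution_entering_Q4 (m p σ α β : ℝ)
    (hm : 1 < m) (hp0 : 0 < p) (hp1 : p < 1) (hmp : 2 < m + p)
    (hσ : 2 * (1 - p) / (m - 1) < σ)
    (hα : α = (σ + 2) / (σ * (m - 1) + 2 * (p - 1)))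
    (hβ : β = (m - p) / (σ * (m - 1) + 2 * (p - 1)))
    (f : ℝ → ℝ) (R : ℝ) (hR : 0 < R)
    (hpos : ∀ ξ ∈ Set.Ioi R, 0 < f ξ)
    (hf : ContDiffOn ℝ 2 f (Set.Ioi R))
    (hode : SolvesODE m p σ α β f (Set.Ioi R))
    (hlim1 : Filter.Tendsto (fun ξ => ξ ^ (σ - 2) * f ξ ^ (m + p - 2))
      Filter.atTop Filter.atTop)
    (hlim2 : Filter.Tendsto (fun ξ => ξ ^ σ * f ξ ^ (p - 1))
      Filter.atTop Filter.atTop) :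
    False := by
  have hσ0 : 0 < σ :=
    lt_of_le_of_lt (div_nonneg (by linarith) (by linarith)) hσ
  have hD : 0 < σ * (m - 1) + 2 * (p - 1) := by
    rw [div_lt_iff₀ (by linarith)] at hσ
    linarith
  have hα0 : 0 < α := hα ▸ div_pos (by linarith) hD
  have hβ0 : 0 < β := hβ ▸ div_pos (by linarith) hD
  obtain ⟨a, ha⟩ := eventually_atTop.1 ((hlim2.eventually_ge_atTop (2 * (α + β))).and
    ((eventually_ge_atTop 1).and (eventually_gt_atTop R)))
  have ha1 : 1 ≤ a := (ha a le_rfl).2.1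
  have hfpos : ∀ x ≥ a, 0 < f x := fun x hx => hpos x (ha x hx).2.2
  have hFm : ContDiffOn ℝ 2 (Fm m f) (Ioi R) :=
    hf.rpow_const_of_ne fun x hx => (hpos x hx).ne'
  have hd1 : ∀ x ≥ a, HasDerivAt f (deriv f x) x := fun x hx =>
    ((hf.differentiableOn (by norm_num)).differentiableAt
      (Ioi_mem_nhds (ha x hx).2.2)).hasDerivAt
  have hw1 : ∀ x ≥ a, HasDerivAt (Fm m f) (deriv (Fm m f) x) x := fun x hx =>
    ((hFm.differentiableOn (by norm_num)).differentiableAt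
      (Ioi_mem_nhds (ha x hx).2.2)).hasDerivAt
  have hw2 : ∀ x ≥ a, HasDerivAt (deriv (Fm m f)) (deriv (deriv (Fm m f)) x) x := fun x hx =>
    (((hFm.deriv_of_isOpen (m := 1) isOpen_Ioi (by norm_num)).differentiableOn
      (by norm_num)).differentiableAt (Ioi_mem_nhds (ha x hx).2.2)).hasDerivAt
  have hchain : ∀ x ≥ a, deriv (Fm m f) x = m * f x ^ (m - 1) * deriv f x := fun x hx => by
    have h : HasDerivAt (Fm m f) (deriv f x * m * f x ^ (m - 1)) x :=
      (hd1 x hx).rpow_const (Or.inl (hfpos x hx).ne')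
    rw [h.deriv]
    ring
  have hsource : ∀ x ≥ a, 2 * (α + β) * f x ≤ x ^ σ * f x ^ p := fun x hx => by
    have e : f x ^ p = f x ^ (p - 1) * f x := by
      rw [← rpow_add_one (hfpos x hx).ne']; congr 1; ring
    rw [e, ← mul_assoc]
    exact mul_le_mul_of_nonneg_right (ha x hx).1 (hfpos x hx).le
  have hode' : ∀ x ≥ a, deriv (deriv (Fm m f)) x - α * f x + β * x * deriv f x
      + x ^ σ * f x ^ p = 0 := fun x hx => hode x (ha x hx).2.2
  have hwpos : ∀ x ≥ a, 0 < Fm m f x := fun x hx => rpow_pos_of_pos (hfpos x hx) m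
  set G : ℝ → ℝ := fun x => deriv (Fm m f) x + β * x * f x with hGdef
  set G' : ℝ → ℝ := fun x => (α + β) * f x - x ^ σ * f x ^ p with hG'def
  have hG : ∀ x ≥ a, HasDerivAt G (G' x) x := fun x hx => by
    have h := (hw2 x hx).add ((((hasDerivAt_id x).const_mul β)).mul (hd1 x hx))
    refine h.congr_deriv ?_
    simp only [hG'def, id]
    linarith [hode' x hx]
  have hG'le : ∀ x ≥ a, G' x ≤ -(x ^ σ * f x ^ p) / 2 := fun x hx => by
    simp only [hG'def]
    linarith [hsource x hx]
  have hsrcpos : ∀ x ≥ a, 0 < x ^ σ * f x ^ p := fun x hx =>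
    mul_pos (rpow_pos_of_pos (by linarith) σ) (rpow_pos_of_pos (hfpos x hx) p)
  have hGanti : StrictAntiOn G (Ici a) := by
    refine strictAntiOn_of_deriv_neg (convex_Ici a)
      (fun y hy => (hG y hy).continuousAt.continuousWithinAt) (fun y hy => ?_)
    have hy' : a ≤ y := interior_subset hy
    rw [(hG y hy').deriv]
    linarith [hG'le y hy', hsrcpos y hy']
  have hG0 : ∀ x ≥ a, 0 ≤ G x := by
    intro x hx
    by_contra! hlt
    obtain ⟨y, hy, hy0⟩ := exists_neg_of_hasDerivAt_le_neg (c := -G x) (by linarith)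
      (fun y (hy : y ≥ x) => hw1 y (hx.le.trans hy)) (fun y hy => by
        have hay : a ≤ y := hx.le.trans hy
        have h1 : G y ≤ G x := hGanti.antitoneOn hx hay hy
        have h2 : 0 < β * y * f y :=
          mul_pos (mul_pos hβ0 (by linarith)) (hfpos y hay)
        simp only [hGdef] at h1 ⊢
        linarith)
    exact absurd hy0 (hwpos y (hx.le.trans hy)).not_gt
  have hGpos : ∀ x ≥ a, 0 < G x := fun x hx =>
    (hG0 (x + 1) (by linarith)).trans_lt
      (hGanti hx (mem_Ici.2 (by linarith)) (by linarith))
  obtain ⟨b, hb, hb0⟩ : ∃ b ≥ a, deriv (Fm m f) b ≤ 0 := by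
    by_contra! hincr
    have hmono : ∀ x ≥ a, f a ≤ f x := fun x hx => by
      have h := sub_le_sub_of_hasDerivAt_le (g := fun _ => 0) (g' := fun _ => 0)
        (fun y _ => hasDerivAt_const y (0 : ℝ)) hd1 (fun y hy => by
          have h := hincr y hy
          rw [hchain y hy] at h
          exact (pos_of_mul_pos_right h (mul_pos (by linarith)
            (rpow_pos_of_pos (hfpos y hy) _)).le).le) hx
      linarith
    obtain ⟨y, hy, hy0⟩ := exists_neg_of_hasDerivAt_le_neg (c := f a ^ p / 2)
      (half_pos (rpow_pos_of_pos (hfpos a le_rfl) p)) hG (fun x hx => by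
        have h1 : 1 ≤ x ^ σ := one_le_rpow (ha1.trans hx) hσ0.le
        have h2 : f a ^ p ≤ f x ^ p :=
          rpow_le_rpow (hfpos a le_rfl).le (hmono x hx) hp0.le
        have h3 : 0 ≤ f x ^ p := (rpow_pos_of_pos (hfpos x hx) p).le
        have h4 := le_mul_of_one_le_left h3 h1
        linarith [hG'le x hx])
    exact absurd hy0 (hG0 y hy).not_gt
  have hdecr : ∀ x ≥ b, deriv (Fm m f) x ≤ 0 := fun x hx =>
    nonpos_of_hasDerivAt_neg_of_eq_zero (fun y (hy : y ≥ b) => hw2 y (hb.le.trans hy))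
      (fun y hy hy0 => by
        have hay : a ≤ y := hb.le.trans hy
        have hf0 : deriv f y = 0 := by
          rw [hchain y hay] at hy0
          exact (mul_eq_zero.1 hy0).resolve_left (mul_pos (by linarith)
            (rpow_pos_of_pos (hfpos y hay) _)).ne'
        have h := hode' y hay
        rw [hf0] at h
        have h1 := mul_pos hα0 (hfpos y hay)
        have h2 := mul_pos hβ0 (hfpos y hay)
        linarith [hsource y hay]) hb0 hx
  refine false_of_hasDerivAt_le_neg_rpow (C := (β ^ p)⁻¹ / 2) (p := p) (ha1.trans hb)
    (half_pos (inv_pos.2 (rpow_pos_of_pos hβ0 p))) hp1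
    (fun x (hx : x ≥ b) => hG x (hb.le.trans hx)) (fun x hx => hGpos x (hb.le.trans hx))
    (fun x hx => ?_)
  have hax : a ≤ x := hb.le.trans hx
  have hx1 : 1 ≤ x := ha1.trans hax
  have hx0 : 0 < x := by linarith
  have hGle : G x ^ p ≤ β ^ p * x ^ p * f x ^ p := by
    rw [← mul_rpow hβ0.le hx0.le, ← mul_rpow (mul_pos hβ0 hx0).le (hfpos x hax).le]
    refine rpow_le_rpow (hGpos x hax).le ?_ hp0.le
    simp only [hGdef]
    linarith [hdecr x hx]
  have hxp : x ^ p ≤ x := by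
    simpa using rpow_le_rpow_of_exponent_le hx1 hp1.le
  have hxσ : 1 ≤ x ^ σ := one_le_rpow hx1 hσ0.le
  have hβp := rpow_pos_of_pos hβ0 p
  have hfp := rpow_pos_of_pos (hfpos x hax) p
  have key : (β ^ p)⁻¹ * G x ^ p / x ≤ x ^ σ * f x ^ p := by
    rw [div_le_iff₀ hx0, inv_mul_le_iff₀ hβp]
    calc G x ^ p ≤ β ^ p * x ^ p * f x ^ p := hGle
      _ ≤ β ^ p * x * f x ^ p := by gcongr
      _ = β ^ p * (1 * f x ^ p * x) := by ring
      _ ≤ β ^ p * (x ^ σ * f x ^ p * x) := by gcongr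
  calc G' x ≤ -(x ^ σ * f x ^ p) / 2 := hG'le x hax
    _ ≤ -((β ^ p)⁻¹ * G x ^ p / x) / 2 := by linarith
    _ = -((β ^ p)⁻¹ / 2) * G x ^ p / x := by ring
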